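/- arXiv:1504.03844 — 3 statements merged into one kernel-verified Lean document; each statement's English description precedes it below -/
import Mathlib

section
/- Fix an integer K ≥ 1. The mean occupancy s̃(ρ_V,ρ_R) = (Σ_{(k,l)∈χ} (k+l)·ρ_V^k ρ_R^l/l!) / Z(ρ_V,ρ_R) is strictly increasing in each of its two arguments on [0,∞)×[0,∞): for all 0 ≤ ρ_V < ρ_V' and ρ_R ≥ 0 one has s̃(ρ_V,ρ_R) < s̃(ρ_V',ρ_R), and for all ρ_V ≥ 0 and 0 ≤ ρ_R < ρ_R' one has s̃(ρ_V,ρ_R) < s̃(ρ_V,ρ_R'). -/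
open Finset

/-- Partition function `Z(ρ_V, ρ_R) = Σ_{k+l ≤ K} ρ_V^k ρ_R^l / l!`. -/
noncomputable def Z (K : ℕ) (x r : ℝ) : ℝ :=
  ∑ k ∈ Finset.range (K + 1), ∑ l ∈ Finset.range (K + 1 - k),
    x ^ k * r ^ l / (Nat.factorial l : ℝ)

/-- Stationary probability `π_{k,l}`. -/
noncomputable def piP (K : ℕ) (x r : ℝ) (k l : ℕ) : ℝ :=
  x ^ k * r ^ l / ((Nat.factorial l : ℝ) * Z K x r)

/-- `π_{0,·}` : probability of an empty station (no vehicles). -/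
noncomputable def piZero (K : ℕ) (x r : ℝ) : ℝ :=
  ∑ l ∈ Finset.range (K + 1), piP K x r 0 l

/-- `π_S` : probability of a saturated station. -/
noncomputable def piSat (K : ℕ) (x r : ℝ) : ℝ :=
  ∑ k ∈ Finset.range (K + 1), piP K x r k (K - k)

/-- Mean occupancy `s̃(ρ_V,ρ_R)`. -/
noncomputable def sTilde (K : ℕ) (x r : ℝ) : ℝ :=
  (∑ k ∈ Finset.range (K + 1), ∑ l ∈ Finset.range (K + 1 - k),
    ((k : ℝ) + (l : ℝ)) * (x ^ k * r ^ l / (Nat.factorial l : ℝ))) / Z K x r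

/-- `f(ρ_V,ρ_R) = (a − ρ_R)·Z(ρ_V,ρ_R) − a·Σ_{l=0}^K ρ_R^l/l!`. -/
noncomputable def fEq (K : ℕ) (a x r : ℝ) : ℝ :=
  (a - r) * Z K x r - a * ∑ l ∈ Finset.range (K + 1), r ^ l / (Nat.factorial l : ℝ)

/-- Proportion of problematic stations `P_b`. -/
noncomputable def Pb (K : ℕ) (x r : ℝ) : ℝ :=
  piZero K x r + piSat K x r - piP K x r 0 K

/-- Upper bound `P_b^+`. -/
noncomputable def PbPlus (K : ℕ) (x r : ℝ) : ℝ :=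
  piZero K x r + piSat K x r

/-- Total weight of the states with occupancy `n`. -/
noncomputable def levelWeight (x r : ℝ) (n : ℕ) : ℝ :=
  ∑ k ∈ Finset.range (n + 1), x ^ k * r ^ (n - k) / (Nat.factorial (n - k) : ℝ)

lemma Z_eq_sum_levelWeight (K : ℕ) (x r : ℝ) :
    Z K x r = ∑ n ∈ Finset.range (K + 1), levelWeight x r n :=
  (Finset.sum_range_diag_flip (K + 1)
    fun k l => x ^ k * r ^ l / (Nat.factorial l : ℝ)).symm

lemma sTilde_eq_levelWeight (K : ℕ) (x r : ℝ) :
    sTilde K x r = (∑ n ∈ Finset.range (K + 1), (n : ℝ) * levelWeight x r n) /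
      ∑ n ∈ Finset.range (K + 1), levelWeight x r n := by
  rw [sTilde, Z_eq_sum_levelWeight, ← Finset.sum_range_diag_flip (K + 1)
    fun k l => ((k : ℝ) + (l : ℝ)) * (x ^ k * r ^ l / (Nat.factorial l : ℝ))]
  congr 1
  refine Finset.sum_congr rfl fun n _ => ?_
  rw [levelWeight, Finset.mul_sum]
  refine Finset.sum_congr rfl fun k hk => ?_
  rw [← Nat.cast_add, Nat.add_sub_cancel' (Finset.mem_range_succ_iff.mp hk)]

lemma levelWeight_zero (x r : ℝ) : levelWeight x r 0 = 1 := by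
  simp [levelWeight]

lemma levelWeight_succ (x r : ℝ) (n : ℕ) :
    levelWeight x r (n + 1) =
      x * levelWeight x r n + r ^ (n + 1) / (Nat.factorial (n + 1) : ℝ) := by
  rw [levelWeight, Finset.sum_range_succ', levelWeight, Finset.mul_sum]
  simp only [Nat.add_sub_add_right, pow_zero, one_mul, Nat.sub_zero]
  congr 1
  refine Finset.sum_congr rfl fun k _ => ?_
  ring

lemma levelWeight_one (x r : ℝ) : levelWeight x r 1 = x + r := by
  simp [levelWeight_succ, levelWeight_zero]

lemma levelWeight_nonneg {x r : ℝ} (hx : 0 ≤ x) (hr : 0 ≤ r) (n : ℕ) :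
    0 ≤ levelWeight x r n :=
  Finset.sum_nonneg fun _ _ => by positivity

lemma levelWeight_pos {x r : ℝ} (hx : 0 ≤ x) (hr : 0 ≤ r) (h : 0 < x + r) (n : ℕ) :
    0 < levelWeight x r n := by
  induction n with
  | zero => simp [levelWeight_zero]
  | succ n ih =>
    rw [levelWeight_succ]
    rcases hx.eq_or_lt with rfl | hx
    · have hr : 0 < r := by simpa using h
      positivity
    · positivity

lemma pow_succ_div_factorial_succ (r : ℝ) (n : ℕ) :
    r ^ (n + 1) / (Nat.factorial (n + 1) : ℝ) =
      r / (n + 1 : ℝ) * (r ^ n / (Nat.factorial n : ℝ)) := by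
  rw [Nat.factorial_succ, Nat.cast_mul, Nat.cast_succ, div_mul_div_comm, pow_succ']

lemma div_mul_levelWeight_le {x r : ℝ} (hx : 0 ≤ x) (hr : 0 ≤ r) (n : ℕ) :
    r / (n + 1 : ℝ) * levelWeight x r n ≤ levelWeight x r (n + 1) := by
  induction n with
  | zero => simp [levelWeight_zero, levelWeight_one, hx]
  | succ n ih =>
    have hle : r / ((n + 1 : ℕ) + 1 : ℝ) ≤ r / (n + 1 : ℝ) := by
      push_cast
      gcongr
      linarith
    rw [levelWeight_succ x r (n + 1), pow_succ_div_factorial_succ r (n + 1)]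
    calc r / ((n + 1 : ℕ) + 1 : ℝ) * levelWeight x r (n + 1)
        = x * (r / ((n + 1 : ℕ) + 1 : ℝ) * levelWeight x r n) +
          r / ((n + 1 : ℕ) + 1 : ℝ) * (r ^ (n + 1) / (Nat.factorial (n + 1) : ℝ)) := by
          rw [levelWeight_succ x r n]; ring
      _ ≤ _ := by
          gcongr
          exact (mul_le_mul_of_nonneg_right hle (levelWeight_nonneg hx hr n)).trans ih

lemma factorial_mul_levelWeight_sub_le {x x' r : ℝ} (hx : 0 ≤ x) (hxx : x ≤ x') (hr : 0 ≤ r)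
    (n : ℕ) :
    r ^ (n + 1) / (Nat.factorial (n + 1) : ℝ) * (levelWeight x' r n - levelWeight x r n) ≤
      (x' - x) * (levelWeight x r n * levelWeight x' r n) := by
  induction n with
  | zero => simpa [levelWeight_zero] using hxx
  | succ n ih =>
    have hx' := hx.trans hxx
    have hd := sub_nonneg.mpr hxx
    have hle' : r / ((n + 1 : ℕ) + 1 : ℝ) * levelWeight x r n ≤ levelWeight x r (n + 1) := by
      refine le_trans ?_ (div_mul_levelWeight_le hx hr n)
      refine mul_le_mul_of_nonneg_right ?_ (levelWeight_nonneg hx hr n)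
      push_cast
      gcongr
      linarith
    set q := r / ((n + 1 : ℕ) + 1 : ℝ) with hq
    have hq0 : 0 ≤ q := by positivity
    have hc0 : 0 ≤ r ^ (n + 1) / (Nat.factorial (n + 1) : ℝ) := by positivity
    rw [pow_succ_div_factorial_succ r (n + 1), ← hq]
    have hs := levelWeight_succ x r n
    have hs' := levelWeight_succ x' r n
    set c := r ^ (n + 1) / (Nat.factorial (n + 1) : ℝ)
    calc q * c * (levelWeight x' r (n + 1) - levelWeight x r (n + 1))
        = q * x' * (c * (levelWeight x' r n - levelWeight x r n)) +
          (x' - x) * c * (q * levelWeight x r n) := by rw [hs, hs']; ring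
      _ ≤ q * x' * ((x' - x) * (levelWeight x r n * levelWeight x' r n)) +
          (x' - x) * c * (q * levelWeight x r n) := by gcongr
      _ = (x' - x) * (q * levelWeight x r n) * levelWeight x' r (n + 1) := by rw [hs']; ring
      _ ≤ (x' - x) * levelWeight x r (n + 1) * levelWeight x' r (n + 1) := by
          have := levelWeight_nonneg hx' hr (n + 1)
          gcongr
      _ = _ := by ring

/-- Monotone likelihood ratio of the occupancy with respect to `x`. -/
lemma levelWeight_ratio_mono_left {x x' r : ℝ} (hx : 0 ≤ x) (hxx : x ≤ x') (hr : 0 ≤ r)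
    (n : ℕ) :
    levelWeight x r (n + 1) * levelWeight x' r n ≤
      levelWeight x r n * levelWeight x' r (n + 1) := by
  rw [levelWeight_succ, levelWeight_succ]
  linarith [factorial_mul_levelWeight_sub_le hx hxx hr n]

lemma factorial_mul_levelWeight_le {x r r' : ℝ} (hx : 0 ≤ x) (hr : 0 ≤ r) (hrr : r ≤ r')
    (n : ℕ) :
    r ^ (n + 1) / (Nat.factorial (n + 1) : ℝ) * levelWeight x r' n ≤
      r' ^ (n + 1) / (Nat.factorial (n + 1) : ℝ) * levelWeight x r n := by
  induction n with
  | zero => simpa [levelWeight_zero] using hrr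
  | succ n ih =>
    have hr' := hr.trans hrr
    have hb := levelWeight_nonneg hx hr' n
    rw [pow_succ_div_factorial_succ r (n + 1), pow_succ_div_factorial_succ r' (n + 1),
      levelWeight_succ x r n, levelWeight_succ x r' n]
    have hq : r / ((n + 1 : ℕ) + 1 : ℝ) ≤ r' / ((n + 1 : ℕ) + 1 : ℝ) := by gcongr
    have hq0 : 0 ≤ r / ((n + 1 : ℕ) + 1 : ℝ) := by positivity
    have hc : 0 ≤ r ^ (n + 1) / (Nat.factorial (n + 1) : ℝ) := by positivity
    have hc' : 0 ≤ r' ^ (n + 1) / (Nat.factorial (n + 1) : ℝ) := by positivity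
    set q := r / ((n + 1 : ℕ) + 1 : ℝ)
    set q' := r' / ((n + 1 : ℕ) + 1 : ℝ)
    set c := r ^ (n + 1) / (Nat.factorial (n + 1) : ℝ)
    set c' := r' ^ (n + 1) / (Nat.factorial (n + 1) : ℝ)
    calc q * c * (x * levelWeight x r' n + c')
        = q * (x * (c * levelWeight x r' n) + c * c') := by ring
      _ ≤ q' * (x * (c' * levelWeight x r n) + c * c') := by gcongr
      _ = _ := by ring

/-- Monotone likelihood ratio of the occupancy with respect to `r`. -/
lemma levelWeight_ratio_mono_right {x r r' : ℝ} (hx : 0 ≤ x) (hr : 0 ≤ r) (hrr : r ≤ r')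
    (n : ℕ) :
    levelWeight x r (n + 1) * levelWeight x r' n ≤
      levelWeight x r n * levelWeight x r' (n + 1) := by
  rw [levelWeight_succ, levelWeight_succ]
  linarith [factorial_mul_levelWeight_le hx hr hrr n]

/-- Weights with an increasing likelihood ratio have an increasing mean. -/
lemma sum_mul_lt_of_ratio_mono {a b : ℕ → ℝ} (hb : ∀ n, 0 < b n)
    (hab : ∀ n, a (n + 1) * b n ≤ a n * b (n + 1)) (h01 : a 1 * b 0 < a 0 * b 1)
    {K : ℕ} (hK : 1 ≤ K) :
    (∑ n ∈ Finset.range (K + 1), (n : ℝ) * a n) * ∑ n ∈ Finset.range (K + 1), b n <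
      (∑ n ∈ Finset.range (K + 1), (n : ℝ) * b n) * ∑ n ∈ Finset.range (K + 1), a n := by
  have hanti : Antitone fun n => a n / b n :=
    antitone_nat_of_succ_le fun n => (div_le_div_iff₀ (hb _) (hb _)).mpr (hab n)
  induction K, hK using Nat.le_induction with
  | base =>
    simp only [Finset.sum_range_succ, Finset.sum_range_zero]
    push_cast
    linarith
  | succ K _ ih =>
    have hsum : 0 ≤ ∑ m ∈ Finset.range (K + 1),
        ((K + 1 : ℕ) - m : ℝ) * (a m * b (K + 1) - a (K + 1) * b m) := by
      refine Finset.sum_nonneg fun m hm => mul_nonneg ?_ ?_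
      · exact sub_nonneg.mpr (Nat.cast_le.mpr (Finset.mem_range.mp hm).le)
      · exact sub_nonneg.mpr ((div_le_div_iff₀ (hb _) (hb _)).mp
          (hanti (Finset.mem_range.mp hm).le))
    have hexp : ∑ m ∈ Finset.range (K + 1),
        ((K + 1 : ℕ) - m : ℝ) * (a m * b (K + 1) - a (K + 1) * b m) =
        (K + 1 : ℕ) * b (K + 1) * (∑ m ∈ Finset.range (K + 1), a m) -
        (K + 1 : ℕ) * a (K + 1) * (∑ m ∈ Finset.range (K + 1), b m) -
        b (K + 1) * (∑ m ∈ Finset.range (K + 1), (m : ℝ) * a m) +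
        a (K + 1) * (∑ m ∈ Finset.range (K + 1), (m : ℝ) * b m) := by
      simp only [Finset.mul_sum, ← Finset.sum_sub_distrib, ← Finset.sum_add_distrib]
      exact Finset.sum_congr rfl fun m _ => by ring
    simp only [Finset.sum_range_succ _ (K + 1)]
    linarith

lemma sum_levelWeight_pos {x r : ℝ} (hx : 0 ≤ x) (hr : 0 ≤ r) (K : ℕ) :
    0 < ∑ n ∈ Finset.range (K + 1), levelWeight x r n :=
  Finset.sum_pos' (fun n _ => levelWeight_nonneg hx hr n)
    ⟨0, by simp, by simp [levelWeight_zero]⟩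

lemma sTilde_lt_sTilde {K : ℕ} (hK : 1 ≤ K) {x r x' r' : ℝ} (hx : 0 ≤ x) (hr : 0 ≤ r)
    (hx' : 0 ≤ x') (hr' : 0 ≤ r') (hlt : x + r < x' + r')
    (hratio : ∀ n, levelWeight x r (n + 1) * levelWeight x' r' n ≤
      levelWeight x r n * levelWeight x' r' (n + 1)) :
    sTilde K x r < sTilde K x' r' := by
  rw [sTilde_eq_levelWeight, sTilde_eq_levelWeight,
    div_lt_div_iff₀ (sum_levelWeight_pos hx hr K) (sum_levelWeight_pos hx' hr' K)]
  refine sum_mul_lt_of_ratio_mono (levelWeight_pos hx' hr' ?_) hratio ?_ hK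
  · linarith
  · simpa [levelWeight_zero, levelWeight_one] using hlt

/-- The mean occupancy sTilde is strictly increasing in each argument on [0,∞)×[0,∞). -/
theorem stmt_9 (K : ℕ) (hK : 1 ≤ K) :
    (∀ x x' r : ℝ, 0 ≤ x → x < x' → 0 ≤ r → sTilde K x r < sTilde K x' r)
    ∧ (∀ x r r' : ℝ, 0 ≤ x → 0 ≤ r → r < r' → sTilde K x r < sTilde K x r') := by
  exact ⟨fun x x' r hx hxx hr => sTilde_lt_sTilde hK hx hr (hx.trans hxx.le) hr (by linarith)
      (levelWeight_ratio_mono_left hx hxx.le hr),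
    fun x r r' hx hr hrr => sTilde_lt_sTilde hK hx hr hx (hr.trans hrr.le) (by linarith)
      (levelWeight_ratio_mono_right hx hr hrr.le)⟩
end

section
/- Fix an integer K ≥ 1. For all reals ρ_V > 0 and ρ_R ≥ 0, one has π_S(1/ρ_V, ρ_R/ρ_V) = π_{0,·}(ρ_V, ρ_R) and π_{0,·}(1/ρ_V, ρ_R/ρ_V) = π_S(ρ_V, ρ_R). -/
open Finset

lemma pow_mul_weight_inv {K k l : ℕ} (h : k + l ≤ K) {x : ℝ} (hx : x ≠ 0) (r : ℝ) :
    x ^ K * ((1 / x) ^ k * (r / x) ^ l) = x ^ (K - k - l) * r ^ l := by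
  obtain ⟨m, rfl⟩ := Nat.exists_eq_add_of_le h
  rw [show k + l + m - k - l = m by omega, pow_add, pow_add, div_pow, div_pow, one_pow]
  field_simp

lemma sum_triangle_reflect (K : ℕ) (f : ℕ → ℕ → ℝ) :
    ∑ k ∈ Finset.range (K + 1), ∑ l ∈ Finset.range (K + 1 - k), f (K - k - l) l =
      ∑ k ∈ Finset.range (K + 1), ∑ l ∈ Finset.range (K + 1 - k), f k l := by
  have swap (g : ℕ → ℕ → ℝ) :
      ∑ k ∈ Finset.range (K + 1), ∑ l ∈ Finset.range (K + 1 - k), g k l =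
        ∑ l ∈ Finset.range (K + 1), ∑ k ∈ Finset.range (K + 1 - l), g k l :=
    Finset.sum_comm' fun k l => by simp only [Finset.mem_range]; omega
  rw [swap fun k l => f (K - k - l) l, swap f]
  refine Finset.sum_congr rfl fun l _ => ?_
  rw [← Finset.sum_range_reflect (fun k => f k l)]
  refine Finset.sum_congr rfl fun k _ => ?_
  rw [show K - k - l = K + 1 - l - 1 - k by omega]

lemma pow_mul_Z_inv (K : ℕ) {x : ℝ} (hx : x ≠ 0) (r : ℝ) :
    x ^ K * Z K (1 / x) (r / x) = Z K x r := by
  unfold Z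
  rw [← sum_triangle_reflect K fun k l => x ^ k * r ^ l / (Nat.factorial l : ℝ), Finset.mul_sum]
  refine Finset.sum_congr rfl fun k hk => ?_
  rw [Finset.mul_sum]
  refine Finset.sum_congr rfl fun l hl => ?_
  rw [Finset.mem_range] at hk hl
  rw [← mul_div_assoc, pow_mul_weight_inv (by omega) hx]

lemma piP_inv {K k l : ℕ} (h : k + l ≤ K) {x : ℝ} (hx : x ≠ 0) (r : ℝ) :
    piP K (1 / x) (r / x) k l = piP K x r (K - k - l) l := by
  unfold piP
  rw [← pow_mul_weight_inv h hx, ← pow_mul_Z_inv K hx, mul_left_comm _ (x ^ K),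
    mul_div_mul_left _ _ (pow_ne_zero K hx)]

/-- Symmetry: piSat(1/x, r/x) = piZero(x, r) and piZero(1/x, r/x) = piSat(x, r). -/
theorem stmt_13 (K : ℕ) (hK : 1 ≤ K) (x r : ℝ) (hx : 0 < x) (hr : 0 ≤ r) :
    piSat K (1 / x) (r / x) = piZero K x r
    ∧ piZero K (1 / x) (r / x) = piSat K x r := by
  unfold piSat piZero
  constructor
  · rw [← Finset.sum_range_reflect (fun l => piP K x r 0 l)]
    refine Finset.sum_congr rfl fun k hk => ?_
    rw [Finset.mem_range] at hk
    rw [piP_inv (by omega) hx.ne', Nat.sub_self, Nat.add_sub_cancel]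
  · rw [← Finset.sum_range_reflect (fun k => piP K x r k (K - k))]
    refine Finset.sum_congr rfl fun l hl => ?_
    rw [Finset.mem_range] at hl
    rw [piP_inv (by omega) hx.ne', Nat.sub_zero, Nat.add_sub_cancel,
      Nat.sub_sub_self (by omega)]
end

section
/- Fix an integer K ≥ 1 and a real a > 0. Let ψ : (0,∞) → [0,a) be a function such that f(x, ψ(x)) = 0 for every x > 0, and suppose the function g(x) = P_b(x, ψ(x)) is differentiable at x = 1. Then g'(1) = 0; that is, the proportion of problematic stations along the equilibrium curve has a critical point (an extremum) at ρ_V = 1. The same conclusion holds for g⁺(x) = P_b^+(x, ψ(x)). -/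
open Finset

/-- The truncated exponential series `Σ_{l=0}^n r^l / l!`. -/
noncomputable def truncExp (n : ℕ) (r : ℝ) : ℝ :=
  ∑ l ∈ Finset.range (n + 1), r ^ l / (Nat.factorial l : ℝ)

theorem truncExp_pos (n : ℕ) {r : ℝ} (hr : 0 ≤ r) : 0 < truncExp n r := by
  unfold truncExp
  rw [Finset.sum_range_succ']
  have : 0 ≤ ∑ l ∈ Finset.range n, r ^ (l + 1) / (Nat.factorial (l + 1) : ℝ) :=
    Finset.sum_nonneg fun l _ => by positivity
  simp only [pow_zero, Nat.factorial_zero, Nat.cast_one, div_one]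
  linarith

theorem truncExp_mul_pow_le {m n : ℕ} (hmn : m < n) {r s : ℝ} (hr : 0 ≤ r) (hrs : r ≤ s) :
    truncExp m s * r ^ n ≤ truncExp m r * s ^ n := by
  unfold truncExp
  rw [Finset.sum_mul, Finset.sum_mul]
  refine Finset.sum_le_sum fun l hl => ?_
  have hs : 0 ≤ s := hr.trans hrs
  obtain ⟨d, rfl⟩ := Nat.exists_eq_add_of_le (show l ≤ n by have := Finset.mem_range.1 hl; omega)
  have h : r ^ d ≤ s ^ d := pow_le_pow_left₀ hr hrs d
  calc s ^ l / (Nat.factorial l : ℝ) * r ^ (l + d)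
      = s ^ l * r ^ l / (Nat.factorial l : ℝ) * r ^ d := by rw [pow_add]; ring
    _ ≤ s ^ l * r ^ l / (Nat.factorial l : ℝ) * s ^ d := by gcongr
    _ = r ^ l / (Nat.factorial l : ℝ) * s ^ (l + d) := by rw [pow_add]; ring

/-- For `m ≤ n` the ratio `truncExp m / truncExp n` is antitone on `[0, ∞)`. -/
theorem truncExp_mul_truncExp_le {m n : ℕ} (hmn : m ≤ n) {r s : ℝ} (hr : 0 ≤ r) (hrs : r ≤ s) :
    truncExp m s * truncExp n r ≤ truncExp m r * truncExp n s := by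
  induction n, hmn using Nat.le_induction with
  | base => rw [mul_comm]
  | succ n hmn ih =>
    have succ_eq (t : ℝ) :
        truncExp (n + 1) t = truncExp n t + t ^ (n + 1) / (Nat.factorial (n + 1) : ℝ) :=
      Finset.sum_range_succ _ _
    have h : truncExp m s * r ^ (n + 1) / (Nat.factorial (n + 1) : ℝ)
        ≤ truncExp m r * s ^ (n + 1) / (Nat.factorial (n + 1) : ℝ) := by
      refine div_le_div_of_nonneg_right ?_ (Nat.cast_nonneg _)
      exact truncExp_mul_pow_le (Nat.lt_succ_of_le hmn) hr hrs
    rw [succ_eq, succ_eq, mul_add, mul_add, ← mul_div_assoc, ← mul_div_assoc]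
    exact add_le_add ih h

/-- The unnormalised weight `Σ_{l=0}^K ρ_V^{K-l} ρ_R^l / l!` of the saturated states. -/
noncomputable def satWeight (K : ℕ) (x r : ℝ) : ℝ :=
  ∑ l ∈ Finset.range (K + 1), x ^ (K - l) * r ^ l / (Nat.factorial l : ℝ)

theorem satWeight_pos (K : ℕ) {x r : ℝ} (hx : 0 < x) (hr : 0 ≤ r) : 0 < satWeight K x r := by
  unfold satWeight
  refine Finset.sum_pos' (fun l _ => by positivity) ⟨0, by simp, ?_⟩
  simp only [pow_zero]
  positivity

theorem Z_eq_sum_truncExp (K : ℕ) (x r : ℝ) :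
    Z K x r = ∑ k ∈ Finset.range (K + 1), x ^ k * truncExp (K - k) r := by
  refine Finset.sum_congr rfl fun k hk => ?_
  rw [truncExp, Finset.mul_sum, Nat.sub_add_comm (Nat.lt_succ_iff.1 (Finset.mem_range.1 hk))]
  exact Finset.sum_congr rfl fun l _ => mul_div_assoc _ _ _

theorem Z_pos (K : ℕ) {x r : ℝ} (hx : 0 < x) (hr : 0 ≤ r) : 0 < Z K x r := by
  rw [Z_eq_sum_truncExp]
  exact Finset.sum_pos (fun k _ => mul_pos (pow_pos hx k) (truncExp_pos _ hr)) (by simp)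

theorem Z_eq_sum_geom (K : ℕ) (x r : ℝ) :
    Z K x r = ∑ l ∈ Finset.range (K + 1),
      (∑ k ∈ Finset.range (K + 1 - l), x ^ k) * (r ^ l / (Nat.factorial l : ℝ)) := by
  unfold Z
  rw [Finset.sum_comm' (t' := Finset.range (K + 1)) (s' := fun l => Finset.range (K + 1 - l))
    (by intro k l; simp only [Finset.mem_range]; omega)]
  refine Finset.sum_congr rfl fun l _ => ?_
  rw [Finset.sum_mul]
  exact Finset.sum_congr rfl fun k _ => mul_div_assoc _ _ _

theorem one_sub_mul_Z (K : ℕ) (x r : ℝ) :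
    (1 - x) * Z K x r = truncExp K r - x * satWeight K x r := by
  rw [Z_eq_sum_geom, truncExp, satWeight, Finset.mul_sum, Finset.mul_sum,
    ← Finset.sum_sub_distrib]
  refine Finset.sum_congr rfl fun l hl => ?_
  rw [← mul_assoc, mul_neg_geom_sum,
    Nat.sub_add_comm (Nat.lt_succ_iff.1 (Finset.mem_range.1 hl)), pow_succ]
  ring

theorem Z_inv (K : ℕ) {x : ℝ} (hx : x ≠ 0) (r : ℝ) :
    Z K x⁻¹ (r / x) = Z K x r / x ^ K := by
  rw [Z_eq_sum_geom, Z_eq_sum_geom, Finset.sum_div]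
  refine Finset.sum_congr rfl fun l hl => ?_
  rw [← Finset.sum_range_reflect (fun k => x ^ k), Finset.sum_mul, Finset.sum_mul,
    Finset.sum_div]
  refine Finset.sum_congr rfl fun k hk => ?_
  have hk' := Finset.mem_range.1 hk
  have hK : x ^ K = x ^ (K + 1 - l - 1 - k) * x ^ k * x ^ l := by
    rw [← pow_add, ← pow_add]
    congr 1
    omega
  rw [hK, div_pow, inv_pow]
  field_simp

theorem truncExp_div (K : ℕ) {x : ℝ} (hx : x ≠ 0) (r : ℝ) :
    truncExp K (r / x) = satWeight K x r / x ^ K := by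
  rw [truncExp, satWeight, Finset.sum_div]
  refine Finset.sum_congr rfl fun l hl => ?_
  have hK : x ^ K = x ^ (K - l) * x ^ l := by
    rw [pow_sub_mul_pow x (Nat.lt_succ_iff.1 (Finset.mem_range.1 hl))]
  rw [hK, div_pow]
  field_simp

theorem satWeight_inv (K : ℕ) {x : ℝ} (hx : x ≠ 0) (r : ℝ) :
    satWeight K x⁻¹ (r / x) = truncExp K r / x ^ K := by
  rw [truncExp, satWeight, Finset.sum_div]
  refine Finset.sum_congr rfl fun l hl => ?_
  have hK : x ^ K = x ^ (K - l) * x ^ l := by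
    rw [pow_sub_mul_pow x (Nat.lt_succ_iff.1 (Finset.mem_range.1 hl))]
  rw [hK, div_pow, inv_pow]
  field_simp

theorem piZero_eq (K : ℕ) (x r : ℝ) : piZero K x r = truncExp K r / Z K x r := by
  rw [piZero, truncExp, Finset.sum_div]
  refine Finset.sum_congr rfl fun l _ => ?_
  rw [piP, pow_zero, one_mul, div_div]

theorem piSat_eq (K : ℕ) (x r : ℝ) : piSat K x r = satWeight K x r / Z K x r := by
  rw [piSat, satWeight, Finset.sum_div,
    ← Finset.sum_range_reflect (fun k => piP K x r k (K - k))]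
  refine Finset.sum_congr rfl fun l hl => ?_
  have hl' := Finset.mem_range.1 hl
  rw [piP, div_div, show K + 1 - 1 - l = K - l by omega, show K - (K - l) = l by omega]

theorem piZero_inv (K : ℕ) {x : ℝ} (hx : x ≠ 0) (r : ℝ) :
    piZero K x⁻¹ (r / x) = piSat K x r := by
  rw [piZero_eq, piSat_eq, truncExp_div K hx, Z_inv K hx,
    div_div_div_cancel_right₀ (pow_ne_zero K hx)]

theorem piSat_inv (K : ℕ) {x : ℝ} (hx : x ≠ 0) (r : ℝ) :
    piSat K x⁻¹ (r / x) = piZero K x r := by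
  rw [piZero_eq, piSat_eq, satWeight_inv K hx, Z_inv K hx,
    div_div_div_cancel_right₀ (pow_ne_zero K hx)]

theorem piP_zero_inv (K : ℕ) {x : ℝ} (hx : x ≠ 0) (r : ℝ) :
    piP K x⁻¹ (r / x) 0 K = piP K x r 0 K := by
  rw [piP, piP, Z_inv K hx, pow_zero, pow_zero, one_mul, one_mul, div_pow, ← mul_div_assoc,
    div_div_div_cancel_right₀ (pow_ne_zero K hx)]

theorem PbPlus_inv (K : ℕ) {x : ℝ} (hx : x ≠ 0) (r : ℝ) :
    PbPlus K x⁻¹ (r / x) = PbPlus K x r := by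
  rw [PbPlus, PbPlus, piZero_inv K hx, piSat_inv K hx, add_comm]

theorem Pb_inv (K : ℕ) {x : ℝ} (hx : x ≠ 0) (r : ℝ) :
    Pb K x⁻¹ (r / x) = Pb K x r := by
  rw [Pb, Pb, piZero_inv K hx, piSat_inv K hx, piP_zero_inv K hx, add_comm (piSat K x r)]

theorem fEq_eq_zero_iff (K : ℕ) (a x r : ℝ) :
    fEq K a x r = 0 ↔ (a - r) * Z K x r = a * truncExp K r :=
  sub_eq_zero

theorem Z_mul_truncExp_le (K : ℕ) {x r s : ℝ} (hx : 0 < x) (hr : 0 ≤ r) (hrs : r ≤ s) :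
    Z K x s * truncExp K r ≤ Z K x r * truncExp K s := by
  rw [Z_eq_sum_truncExp, Z_eq_sum_truncExp, Finset.sum_mul, Finset.sum_mul]
  refine Finset.sum_le_sum fun k _ => ?_
  rw [mul_assoc, mul_assoc]
  exact mul_le_mul_of_nonneg_left (truncExp_mul_truncExp_le (Nat.sub_le K k) hr hrs)
    (pow_nonneg hx.le k)

theorem not_lt_of_fEq_eq_zero (K : ℕ) {a x r s : ℝ} (hx : 0 < x) (hr : 0 ≤ r) (hsa : s < a)
    (hfr : fEq K a x r = 0) (hfs : fEq K a x s = 0) : ¬ r < s := by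
  intro hrs
  rw [fEq_eq_zero_iff] at hfr hfs
  have hs : 0 ≤ s := hr.trans hrs.le
  have hpos : 0 < Z K x r * truncExp K s := mul_pos (Z_pos K hx hr) (truncExp_pos K hs)
  have heq : (a - r) * (Z K x r * truncExp K s) = (a - s) * (Z K x s * truncExp K r) := by
    rw [← mul_assoc, ← mul_assoc, hfr, hfs]
    ring
  have hle := mul_le_mul_of_nonneg_left (Z_mul_truncExp_le K hx hr hrs.le) (sub_pos.2 hsa).le
  have hlt := mul_lt_mul_of_pos_right (sub_lt_sub_left hrs a) hpos
  linarith

theorem eq_of_fEq_eq_zero (K : ℕ) {a x r s : ℝ} (hx : 0 < x) (hr : 0 ≤ r) (hra : r < a)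
    (hs : 0 ≤ s) (hsa : s < a) (hfr : fEq K a x r = 0) (hfs : fEq K a x s = 0) : r = s :=
  le_antisymm (not_lt.1 (not_lt_of_fEq_eq_zero K hx hs hra hfs hfr))
    (not_lt.1 (not_lt_of_fEq_eq_zero K hx hr hsa hfr hfs))

theorem sub_div_mul_Z_of_fEq_eq_zero (K : ℕ) {a x r : ℝ} (hx : x ≠ 0) (hf : fEq K a x r = 0) :
    (a - r / x) * Z K x r = a * satWeight K x r := by
  rw [fEq_eq_zero_iff] at hf
  have h := one_sub_mul_Z K x r
  field_simp
  linear_combination hf - a * h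

theorem fEq_inv_eq_zero (K : ℕ) {a x r : ℝ} (hx : x ≠ 0) (hf : fEq K a x r = 0) :
    fEq K a x⁻¹ (r / x) = 0 := by
  rw [fEq_eq_zero_iff, Z_inv K hx, truncExp_div K hx, ← mul_div_assoc, ← mul_div_assoc,
    sub_div_mul_Z_of_fEq_eq_zero K hx hf]

theorem div_lt_of_fEq_eq_zero (K : ℕ) {a x r : ℝ} (ha : 0 < a) (hx : 0 < x) (hr : 0 ≤ r)
    (hf : fEq K a x r = 0) : r / x < a := by
  have h : 0 < (a - r / x) * Z K x r := by
    rw [sub_div_mul_Z_of_fEq_eq_zero K hx.ne' hf]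
    exact mul_pos ha (satWeight_pos K hx hr)
  exact sub_pos.1 (pos_of_mul_pos_left h (Z_pos K hx hr).le)

theorem deriv_one_eq_zero_of_inv_eq {g : ℝ → ℝ} (hg : DifferentiableAt ℝ g 1)
    (hinv : ∀ x, 0 < x → g x⁻¹ = g x) : deriv g 1 = 0 := by
  have h₁ : HasDerivAt g (deriv g 1) (1 : ℝ)⁻¹ := by simpa using hg.hasDerivAt
  have h₂ : HasDerivAt (fun x => g x⁻¹) (-deriv g 1) 1 := by
    simpa [Function.comp_def] using h₁.comp (1 : ℝ) (hasDerivAt_inv (one_ne_zero (α := ℝ)))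
  have h₃ : HasDerivAt g (-deriv g 1) 1 := by
    refine h₂.congr_of_eventuallyEq ?_
    filter_upwards [lt_mem_nhds (zero_lt_one' ℝ)] with x hx using (hinv x hx).symm
  have := h₃.unique hg.hasDerivAt
  linarith

/-- Along the equilibrium curve, Pb (and Pb+) has a critical point at x = 1. -/
theorem stmt_15 (K : ℕ) (hK : 1 ≤ K) (a : ℝ) (ha : 0 < a)
    (ψ : ℝ → ℝ) (hψmem : ∀ x : ℝ, 0 < x → 0 ≤ ψ x ∧ ψ x < a)
    (hψ : ∀ x : ℝ, 0 < x → fEq K a x (ψ x) = 0) :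
    (DifferentiableAt ℝ (fun x => Pb K x (ψ x)) 1 →
      deriv (fun x => Pb K x (ψ x)) 1 = 0)
    ∧ (DifferentiableAt ℝ (fun x => PbPlus K x (ψ x)) 1 →
      deriv (fun x => PbPlus K x (ψ x)) 1 = 0) := by
  have hsymm : ∀ x : ℝ, 0 < x → ψ x⁻¹ = ψ x / x := fun x hx => by
    obtain ⟨h₀, -⟩ := hψmem x hx
    obtain ⟨h₁, h₂⟩ := hψmem x⁻¹ (inv_pos.2 hx)
    exact eq_of_fEq_eq_zero K (inv_pos.2 hx) h₁ h₂ (div_nonneg h₀ hx.le)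
      (div_lt_of_fEq_eq_zero K ha hx h₀ (hψ x hx)) (hψ _ (inv_pos.2 hx))
      (fEq_inv_eq_zero K hx.ne' (hψ x hx))
  refine ⟨fun hg => deriv_one_eq_zero_of_inv_eq hg fun x hx => ?_,
    fun hg => deriv_one_eq_zero_of_inv_eq hg fun x hx => ?_⟩
  · simp only [hsymm x hx, Pb_inv K hx.ne']
  · simp only [hsymm x hx, PbPlus_inv K hx.ne']
end
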